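/- For all κ, κ' > 0 there exists a constant C(κ,κ') > 0 such that for all smooth compactly supported maps u : ℝ² → ℝ² and θ, θ₁ : ℝ² → ℝ², |Σ_{i,k=1}^{2} ∫_{ℝ²} u_i(x) ∂_i θ₁_k(x) Δθ_k(x) dx| ≤ κ ‖Δθ‖₂² + κ' ‖∇u‖₂² + C(κ,κ') ‖u‖₂² ‖∇θ₁‖₂² ‖Δθ₁‖₂², where Δθ_k = ∂₁₁θ_k + ∂₂₂θ_k. -/

import Mathlib

open MeasureTheory

noncomputable section

/-- Partial derivative of a real-valued function on `ℝ²` in the `i`-th coordinate direction. -/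
def pderivE (g : (Fin 2 → ℝ) → ℝ) (i : Fin 2) (x : Fin 2 → ℝ) : ℝ :=
  fderiv ℝ g x (Pi.single i 1)

/-- The Navier–Stokes trilinear form
`b(u,v,w) = ∑ i j, ∫ u_i ∂_i v_j w_j`. -/
def formB (u v w : (Fin 2 → ℝ) → (Fin 2 → ℝ)) : ℝ :=
  ∑ i : Fin 2, ∑ j : Fin 2, ∫ x : Fin 2 → ℝ, u x i * pderivE (fun y => v y j) i x * w x j

/-- The Ericksen stress trilinear form
`m(θ₁,θ₂,u) = −∑ i j k, ∫ ∂_i θ₁^k ∂_j θ₂^k ∂_j u^i`. -/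
def formM (t1 t2 u : (Fin 2 → ℝ) → (Fin 2 → ℝ)) : ℝ :=
  -∑ i : Fin 2, ∑ j : Fin 2, ∑ k : Fin 2, ∫ x : Fin 2 → ℝ,
    pderivE (fun y => t1 y k) i x * pderivE (fun y => t2 y k) j x *
      pderivE (fun y => u y i) j x

/-- `u` is divergence-free: `∂₁u₁ + ∂₂u₂ = 0` everywhere. -/
def DivergenceFree (u : (Fin 2 → ℝ) → (Fin 2 → ℝ)) : Prop :=
  ∀ x, (∑ i : Fin 2, pderivE (fun y => u y i) i x) = 0

/-- The `L²` norm of an `ℝ²`-valued map. -/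
def l2norm (g : (Fin 2 → ℝ) → (Fin 2 → ℝ)) : ℝ :=
  (∫ x : Fin 2 → ℝ, ∑ k : Fin 2, (g x k) ^ 2) ^ (1/2 : ℝ)

/-- The `L²` norm of the gradient of an `ℝ²`-valued map. -/
def gradNorm (g : (Fin 2 → ℝ) → (Fin 2 → ℝ)) : ℝ :=
  (∫ x : Fin 2 → ℝ, ∑ i : Fin 2, ∑ k : Fin 2, (pderivE (fun y => g y k) i x) ^ 2) ^ (1/2 : ℝ)

/-- The `L²` norm of a real-valued function. -/
def l2normR (g : (Fin 2 → ℝ) → ℝ) : ℝ :=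
  (∫ x : Fin 2 → ℝ, (g x) ^ 2) ^ (1/2 : ℝ)

/-- The `L²` norm of the gradient of a real-valued function. -/
def gradNormR (g : (Fin 2 → ℝ) → ℝ) : ℝ :=
  (∫ x : Fin 2 → ℝ, ∑ i : Fin 2, (pderivE g i x) ^ 2) ^ (1/2 : ℝ)

/-- The `k`-th component of the (componentwise) Laplacian `Δg_k = ∂₁₁ g_k + ∂₂₂ g_k`. -/
def lapComp (g : (Fin 2 → ℝ) → (Fin 2 → ℝ)) (k : Fin 2) (x : Fin 2 → ℝ) : ℝ :=
  ∑ i : Fin 2, pderivE (pderivE (fun y => g y k) i) i x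

/-- The `L²` norm of the componentwise Laplacian. -/
def lapNorm (g : (Fin 2 → ℝ) → (Fin 2 → ℝ)) : ℝ :=
  (∫ x : Fin 2 → ℝ, ∑ k : Fin 2, (lapComp g k x) ^ 2) ^ (1/2 : ℝ)

/-- The `L^{4N+2}` norm of an `ℝ²`-valued map (written using `|v|^{4N+2} = (|v|²)^{2N+1}`). -/
def lqNorm (N : ℕ) (g : (Fin 2 → ℝ) → (Fin 2 → ℝ)) : ℝ :=
  (∫ x : Fin 2 → ℝ, (∑ k : Fin 2, (g x k) ^ 2) ^ (2 * N + 1)) ^ (1 / (4 * (N:ℝ) + 2))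

/-- The polynomial nonlinearity `f(θ) = (∑_{j=0}^{N} b_j |θ|^{2j}) θ`. -/
def polyF (N : ℕ) (b : Fin (N + 1) → ℝ) (v : Fin 2 → ℝ) : Fin 2 → ℝ :=
  fun k => (∑ j : Fin (N + 1), b j * (∑ l : Fin 2, (v l) ^ 2) ^ (j : ℕ)) * v k

theorem hasCompactSupport_pow {f : (Fin 2 → ℝ) → ℝ} (hf : HasCompactSupport f) {n : ℕ}
    (hn : n ≠ 0) : HasCompactSupport (fun x => f x ^ n) :=
  hf.comp_left (g := fun t : ℝ => t ^ n) (zero_pow hn)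

theorem hasCompactSupport_abs {f : (Fin 2 → ℝ) → ℝ} (hf : HasCompactSupport f) :
    HasCompactSupport (fun x => |f x|) :=
  hf.comp_left (g := fun t : ℝ => |t|) abs_zero

theorem integrable_sq {f : (Fin 2 → ℝ) → ℝ} (hf : Continuous f) (hfc : HasCompactSupport f) :
    Integrable (fun x => f x ^ 2) :=
  (hf.pow 2).integrable_of_hasCompactSupport (hasCompactSupport_pow hfc (by simp))

/-- Cauchy–Schwarz inequality for continuous compactly supported real functions. -/
theorem sq_integral_mul_le {f g : (Fin 2 → ℝ) → ℝ}
    (hf : Continuous f) (hfc : HasCompactSupport f)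
    (hg : Continuous g) (hgc : HasCompactSupport g) :
    (∫ x, f x * g x) ^ 2 ≤ (∫ x, f x ^ 2) * ∫ x, g x ^ 2 := by
  have hff := integrable_sq hf hfc
  have hgg := integrable_sq hg hgc
  have hfg : Integrable (fun x => f x * g x) :=
    (hf.mul hg).integrable_of_hasCompactSupport hfc.mul_right
  have h := discrim_le_zero (a := ∫ x, f x ^ 2) (b := 2 * ∫ x, f x * g x) (c := ∫ x, g x ^ 2)
    (fun t => by
      have h0 : 0 ≤ ∫ x, (t * f x + g x) ^ 2 := integral_nonneg fun x => sq_nonneg _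
      have h1 : ∫ x, (t * f x + g x) ^ 2 =
          ∫ x, (t ^ 2 * f x ^ 2 + 2 * t * (f x * g x) + g x ^ 2) := by
        congr 1; ext x; ring
      have hsum : Integrable (fun x => t ^ 2 * f x ^ 2 + 2 * t * (f x * g x)) :=
        (hff.const_mul _).add (hfg.const_mul _)
      rw [h1, integral_add hsum hgg,
        integral_add (hff.const_mul _) (hfg.const_mul _), integral_const_mul,
        integral_const_mul] at h0
      linarith)
  rw [discrim] at h
  linarith

theorem contDiff_pderivE {f : (Fin 2 → ℝ) → ℝ} (hf : ContDiff ℝ (⊤ : ℕ∞) f) (i : Fin 2) :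
    ContDiff ℝ (⊤ : ℕ∞) (pderivE f i) :=
  (hf.fderiv_right (m := (⊤ : ℕ∞)) (by simp)).clm_apply contDiff_const

theorem hasCompactSupport_pderivE {f : (Fin 2 → ℝ) → ℝ} (hf : HasCompactSupport f) (i : Fin 2) :
    HasCompactSupport (pderivE f i) :=
  hf.fderiv_apply ℝ _

theorem pderivE_comm {f : (Fin 2 → ℝ) → ℝ} (hf : ContDiff ℝ (⊤ : ℕ∞) f) (i j : Fin 2) :
    pderivE (pderivE f i) j = pderivE (pderivE f j) i := by
  have key (i j : Fin 2) (x : Fin 2 → ℝ) : pderivE (pderivE f i) j x =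
      fderiv ℝ (fderiv ℝ f) x (Pi.single j 1) (Pi.single i 1) := by
    have hd : DifferentiableAt ℝ (fderiv ℝ f) x :=
      ((hf.fderiv_right (m := (⊤ : ℕ∞)) (by simp)).differentiable (by simp)).differentiableAt
    change fderiv ℝ (fun y => fderiv ℝ f y (Pi.single i 1)) x (Pi.single j 1) = _
    rw [fderiv_clm_apply hd (differentiableAt_const _)]
    simp
  ext x
  rw [key, key]
  exact (hf.contDiffAt.isSymmSndFDerivAt (by simpa using WithTop.coe_le_coe.2 (le_top (a := (2 : ℕ∞))))).eq _ _

theorem integral_mul_pderivE {f g : (Fin 2 → ℝ) → ℝ}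
    (hf : ContDiff ℝ (⊤ : ℕ∞) f) (hfc : HasCompactSupport f)
    (hg : ContDiff ℝ (⊤ : ℕ∞) g) (i : Fin 2) :
    ∫ x, f x * pderivE g i x = -∫ x, pderivE f i x * g x :=
  integral_mul_fderiv_eq_neg_fderiv_mul_of_integrable
    (((contDiff_pderivE hf i).continuous.mul hg.continuous).integrable_of_hasCompactSupport
      (hasCompactSupport_pderivE hfc i).mul_right)
    ((hf.continuous.mul (contDiff_pderivE hg i).continuous).integrable_of_hasCompactSupport
      hfc.mul_right)
    ((hf.continuous.mul hg.continuous).integrable_of_hasCompactSupport hfc.mul_right)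
    (fun _ _ => (hf.differentiable (by simp)).differentiableAt)
    (fun _ _ => (hg.differentiable (by simp)).differentiableAt)

theorem integral_sq_pderivE_pderivE {f : (Fin 2 → ℝ) → ℝ}
    (hf : ContDiff ℝ (⊤ : ℕ∞) f) (hfc : HasCompactSupport f) (i j : Fin 2) :
    ∫ x, pderivE (pderivE f i) j x ^ 2 =
      ∫ x, pderivE (pderivE f i) i x * pderivE (pderivE f j) j x := by
  have hi := contDiff_pderivE hf i
  have hj := contDiff_pderivE hf j
  have hic := hasCompactSupport_pderivE hfc i
  have h1 := integral_mul_pderivE hi hic (contDiff_pderivE hi j) j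
  have h2 := integral_mul_pderivE hi hic (contDiff_pderivE hj j) i
  have h3 : pderivE (pderivE (pderivE f i) j) j = pderivE (pderivE (pderivE f j) j) i := by
    rw [pderivE_comm hf i j, pderivE_comm hj i j]
  rw [h3] at h1
  simp only [sq]
  linarith

/-- The `L²` norm of the Hessian equals that of the Laplacian. -/
theorem sum_integral_sq_pderivE_pderivE {f : (Fin 2 → ℝ) → ℝ}
    (hf : ContDiff ℝ (⊤ : ℕ∞) f) (hfc : HasCompactSupport f) :
    ∑ i : Fin 2, ∑ j : Fin 2, ∫ x, pderivE (pderivE f i) j x ^ 2 =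
      ∫ x, (∑ i : Fin 2, pderivE (pderivE f i) i x) ^ 2 := by
  have hint (i j : Fin 2) :
      Integrable (fun x => pderivE (pderivE f i) i x * pderivE (pderivE f j) j x) :=
    ((contDiff_pderivE (contDiff_pderivE hf i) i).continuous.mul
      (contDiff_pderivE (contDiff_pderivE hf j) j).continuous).integrable_of_hasCompactSupport
      (hasCompactSupport_pderivE (hasCompactSupport_pderivE hfc i) i).mul_right
  simp only [integral_sq_pderivE_pderivE hf hfc]
  simp only [sq, Finset.sum_mul_sum]
  rw [integral_finsetSum _ fun i _ => integrable_finsetSum _ fun j _ => hint i j]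
  exact Finset.sum_congr rfl fun i _ => (integral_finsetSum _ fun j _ => hint i j).symm

theorem norm_fderiv_le_sum_abs_pderivE (f : (Fin 2 → ℝ) → ℝ) (x : Fin 2 → ℝ) :
    ‖fderiv ℝ f x‖ ≤ ∑ i : Fin 2, |pderivE f i x| := by
  refine ContinuousLinearMap.opNorm_le_bound _ (by positivity) fun v => ?_
  rw [← ContinuousLinearMap.coe_coe, LinearMap.pi_apply_eq_sum_univ, Finset.sum_mul]
  refine (norm_sum_le _ _).trans (Finset.sum_le_sum fun i _ => ?_)
  have h : (fun j => if i = j then (1 : ℝ) else 0) = Pi.single i 1 := by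
    ext j; simp [Pi.single_apply, eq_comm]
  rw [h, norm_smul, mul_comm]
  exact mul_le_mul_of_nonneg_left (norm_le_pi_norm v i) (abs_nonneg _)

/-- Ladyzhenskaya's inequality in the plane. -/
theorem integral_pow_four_le {f : (Fin 2 → ℝ) → ℝ}
    (hf : ContDiff ℝ (⊤ : ℕ∞) f) (hfc : HasCompactSupport f) :
    ∫ x, f x ^ 4 ≤ 8 * (∫ x, f x ^ 2) * ∑ i : Fin 2, ∫ x, pderivE f i x ^ 2 := by
  have hcd (i : Fin 2) := (contDiff_pderivE hf i).continuous
  have hcs (i : Fin 2) := hasCompactSupport_pderivE hfc i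
  have hsq : ContDiff ℝ 1 (fun x => f x ^ 2) := (hf.pow 2).of_le (by simp)
  have hsqc : HasCompactSupport (fun x => f x ^ 2) :=
    hasCompactSupport_pow hfc (by simp)
  set D : (Fin 2 → ℝ) → ℝ := fun x => ∑ i : Fin 2, |pderivE f i x| with hD
  have hDc : Continuous D := by fun_prop
  have hDs : HasCompactSupport D := by
    simp only [hD, Fin.sum_univ_two]
    exact (hasCompactSupport_abs (hcs 0)).add
      (hasCompactSupport_abs (hcs 1))
  have hD0 (x) : 0 ≤ D x := Finset.sum_nonneg fun _ _ => abs_nonneg _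
  have hac : Continuous (fun x => |f x|) := hf.continuous.abs
  have has : HasCompactSupport (fun x => |f x|) := hasCompactSupport_abs hfc
  have hint4 : Integrable (fun x => f x ^ 4) :=
    (hf.continuous.pow 4).integrable_of_hasCompactSupport
      (hasCompactSupport_pow hfc (by simp))
  have hint1 : Integrable (fun x => 2 * (|f x| * D x)) :=
    ((hac.mul hDc).integrable_of_hasCompactSupport has.mul_right).const_mul 2
  have hfd (x) : ‖fderiv ℝ (fun x => f x ^ 2) x‖ ≤ 2 * (|f x| * D x) := by
    have hdf : DifferentiableAt ℝ f x := (hf.differentiable (by simp)).differentiableAt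
    have he : fderiv ℝ (fun x => f x ^ 2) x = (2 * f x) • fderiv ℝ f x := by
      simpa using (hdf.hasFDerivAt.pow 2).fderiv
    rw [he, norm_smul, Real.norm_eq_abs, abs_mul, abs_two, mul_assoc]
    gcongr
    exact norm_fderiv_le_sum_abs_pderivE f x
  have hgns := lintegral_pow_le_pow_lintegral_fderiv_aux (ι := Fin 2) (p := 2)
    (by simpa using Real.HolderConjugate.two_two) hsq hsqc
  have hl : ∫⁻ x, ‖f x ^ 2‖ₑ ^ (2 : ℝ) = ENNReal.ofReal (∫ x, f x ^ 4) := by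
    rw [ofReal_integral_eq_lintegral_ofReal hint4 (ae_of_all _ fun x => by positivity)]
    refine lintegral_congr fun x => ?_
    rw [← ofReal_norm, ENNReal.ofReal_rpow_of_nonneg (norm_nonneg _) (by norm_num)]
    congr 1
    rw [Real.norm_eq_abs, abs_of_nonneg (sq_nonneg _)]
    norm_cast
    ring
  have hr : ∫⁻ x, ‖fderiv ℝ (fun x => f x ^ 2) x‖ₑ ≤
      ENNReal.ofReal (∫ x, 2 * (|f x| * D x)) := by
    rw [ofReal_integral_eq_lintegral_ofReal hint1
      (ae_of_all _ fun x => by have := hD0 x; positivity)]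
    refine lintegral_mono fun x => ?_
    rw [← ofReal_norm]
    exact ENNReal.ofReal_le_ofReal (hfd x)
  have hI0 : 0 ≤ ∫ x, 2 * (|f x| * D x) :=
    integral_nonneg fun x => by have := hD0 x; positivity
  have h1 : ∫ x, f x ^ 4 ≤ (∫ x, 2 * (|f x| * D x)) ^ 2 := by
    rw [hl] at hgns
    have h := hgns.trans (ENNReal.rpow_le_rpow hr (by norm_num))
    rw [ENNReal.ofReal_rpow_of_nonneg hI0 (by norm_num),
      ENNReal.ofReal_le_ofReal_iff (by positivity)] at h
    exact_mod_cast h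
  have h2 := sq_integral_mul_le hac has hDc hDs
  simp only [sq_abs] at h2
  have h3 : ∫ x, D x ^ 2 ≤ 2 * ∑ i : Fin 2, ∫ x, pderivE f i x ^ 2 := by
    rw [← integral_finsetSum _ fun i _ => integrable_sq (hcd i) (hcs i), ← integral_const_mul]
    refine integral_mono (integrable_sq hDc hDs)
      ((integrable_finsetSum _ fun i _ => integrable_sq (hcd i) (hcs i)).const_mul 2) fun x => ?_
    simp only [hD, Fin.sum_univ_two]
    nlinarith [sq_nonneg (|pderivE f 0 x| - |pderivE f 1 x|), sq_abs (pderivE f 0 x),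
      sq_abs (pderivE f 1 x)]
  have h4 : 0 ≤ ∫ x, f x ^ 2 := integral_nonneg fun x => sq_nonneg _
  rw [integral_const_mul] at h1
  nlinarith [mul_le_mul_of_nonneg_left h3 h4]

theorem abs_integral_mul_mul_le {κ κ' : ℝ} (hκ : 0 < κ) (hκ' : 0 < κ')
    {f g w : (Fin 2 → ℝ) → ℝ}
    (hf : ContDiff ℝ (⊤ : ℕ∞) f) (hfc : HasCompactSupport f)
    (hg : ContDiff ℝ (⊤ : ℕ∞) g) (hgc : HasCompactSupport g)
    (hw : Continuous w) (hwc : HasCompactSupport w) :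
    |∫ x, f x * g x * w x| ≤ κ * (∫ x, w x ^ 2) +
      κ' * (∑ i : Fin 2, ∫ x, pderivE f i x ^ 2) +
      1 / (κ ^ 2 * κ') * (∫ x, f x ^ 2) * (∫ x, g x ^ 2) *
        ∑ i : Fin 2, ∫ x, pderivE g i x ^ 2 := by
  have hfq : Continuous (fun x => f x ^ 2) := hf.continuous.pow 2
  have hgq : Continuous (fun x => g x ^ 2) := hg.continuous.pow 2
  have hfqc : HasCompactSupport (fun x => f x ^ 2) :=
    hasCompactSupport_pow hfc (by simp)
  have hgqc : HasCompactSupport (fun x => g x ^ 2) :=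
    hasCompactSupport_pow hgc (by simp)
  have hw2 := integrable_sq hw hwc
  have hfg : Integrable (fun x => f x ^ 2 * g x ^ 2) :=
    (hfq.mul hgq).integrable_of_hasCompactSupport hfqc.mul_right
  have hY := sq_integral_mul_le hfq hfqc hgq hgqc
  have hX : |∫ x, f x * g x * w x| ≤
      κ * (∫ x, w x ^ 2) + 1 / (4 * κ) * ∫ x, f x ^ 2 * g x ^ 2 := by
    rw [← integral_const_mul, ← integral_const_mul,
      ← integral_add (hw2.const_mul _) (hfg.const_mul _)]
    refine abs_integral_le_integral_abs.trans (integral_mono_of_nonneg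
      (ae_of_all _ fun x => abs_nonneg _) ((hw2.const_mul _).add (hfg.const_mul _))
      (ae_of_all _ fun x => ?_))
    have e : κ * w x ^ 2 + 1 / (4 * κ) * (f x ^ 2 * g x ^ 2) - |f x * g x| * |w x| =
        1 / (4 * κ) * (2 * κ * |w x| - |f x * g x|) ^ 2 := by
      rw [sub_sq, mul_pow (2 * κ), sq_abs, sq_abs]
      field_simp
      ring
    have : 0 ≤ 1 / (4 * κ) * (2 * κ * |w x| - |f x * g x|) ^ 2 := by positivity
    simp only [abs_mul (f x * g x)]
    linarith
  have hF := integral_pow_four_le hf hfc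
  have hG := integral_pow_four_le hg hgc
  simp only [← pow_mul] at hY
  norm_num at hY
  have hF0 : 0 ≤ ∫ x, f x ^ 2 := integral_nonneg fun x => sq_nonneg _
  have hG0 : 0 ≤ ∫ x, g x ^ 2 := integral_nonneg fun x => sq_nonneg _
  have hG4 : 0 ≤ ∫ x, g x ^ 4 := integral_nonneg fun x => by positivity
  have hF1 : 0 ≤ ∑ i : Fin 2, ∫ x, pderivE f i x ^ 2 :=
    Finset.sum_nonneg fun i _ => integral_nonneg fun x => sq_nonneg _
  have hG1 : 0 ≤ ∑ i : Fin 2, ∫ x, pderivE g i x ^ 2 :=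
    Finset.sum_nonneg fun i _ => integral_nonneg fun x => sq_nonneg _
  set F := ∫ x, f x ^ 2
  set G := ∫ x, g x ^ 2
  set F' := ∑ i : Fin 2, ∫ x, pderivE f i x ^ 2
  set G' := ∑ i : Fin 2, ∫ x, pderivE g i x ^ 2
  set Y := ∫ x, f x ^ 2 * g x ^ 2
  have hYb : Y ^ 2 ≤ (8 * F * F') * (8 * G * G') :=
    hY.trans (mul_le_mul hF hG hG4 (by positivity))
  have hfin : 1 / (4 * κ) * Y ≤ κ' * F' + 1 / (κ ^ 2 * κ') * F * G * G' := by
    refine le_of_sq_le_sq ?_ (by positivity)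
    have e : 4 * (κ' * F') * (1 / (κ ^ 2 * κ') * F * G * G') =
        1 / (16 * κ ^ 2) * ((8 * F * F') * (8 * G * G')) := by
      field_simp
      ring
    calc (1 / (4 * κ) * Y) ^ 2 = 1 / (16 * κ ^ 2) * Y ^ 2 := by field_simp; ring
      _ ≤ 1 / (16 * κ ^ 2) * ((8 * F * F') * (8 * G * G')) := by gcongr
      _ ≤ _ := by
        rw [← e]
        nlinarith [sq_nonneg (κ' * F' - 1 / (κ ^ 2 * κ') * F * G * G')]
  linarith

theorem rpow_half_sq {a : ℝ} (ha : 0 ≤ a) : (a ^ (1 / 2 : ℝ)) ^ 2 = a := by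
  rw [← Real.sqrt_eq_rpow, Real.sq_sqrt ha]

section VectorNorms

variable {g : (Fin 2 → ℝ) → (Fin 2 → ℝ)}

theorem contDiff_component (hg : ContDiff ℝ (⊤ : ℕ∞) g) (k : Fin 2) :
    ContDiff ℝ (⊤ : ℕ∞) (fun y => g y k) :=
  contDiff_pi.1 hg k

theorem hasCompactSupport_component (hgc : HasCompactSupport g) (k : Fin 2) :
    HasCompactSupport (fun y => g y k) :=
  hgc.comp_left (g := fun v : Fin 2 → ℝ => v k) rfl

theorem continuous_lapComp (hg : ContDiff ℝ (⊤ : ℕ∞) g) (k : Fin 2) :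
    Continuous (lapComp g k) :=
  continuous_finsetSum _ fun i _ =>
    (contDiff_pderivE (contDiff_pderivE (contDiff_component hg k) i) i).continuous

theorem hasCompactSupport_lapComp (hgc : HasCompactSupport g) (k : Fin 2) :
    HasCompactSupport (lapComp g k) := by
  have h (i : Fin 2) := hasCompactSupport_pderivE
    (hasCompactSupport_pderivE (hasCompactSupport_component hgc k) i) i
  have e : lapComp g k = pderivE (pderivE (fun y => g y k) 0) 0 +
      pderivE (pderivE (fun y => g y k) 1) 1 := by
    ext x; simp [lapComp]
  rw [e]
  exact (h 0).add (h 1)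

theorem l2norm_sq (hg : ContDiff ℝ (⊤ : ℕ∞) g) (hgc : HasCompactSupport g) :
    l2norm g ^ 2 = ∑ k : Fin 2, ∫ x, g x k ^ 2 := by
  rw [l2norm, rpow_half_sq (integral_nonneg fun x => Finset.sum_nonneg fun k _ => sq_nonneg _)]
  exact integral_finsetSum _ fun k _ =>
    integrable_sq (contDiff_component hg k).continuous (hasCompactSupport_component hgc k)

theorem gradNorm_sq (hg : ContDiff ℝ (⊤ : ℕ∞) g) (hgc : HasCompactSupport g) :
    gradNorm g ^ 2 = ∑ i : Fin 2, ∑ k : Fin 2, ∫ x, pderivE (fun y => g y k) i x ^ 2 := by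
  have h (i k : Fin 2) : Integrable (fun x => pderivE (fun y => g y k) i x ^ 2) :=
    integrable_sq (contDiff_pderivE (contDiff_component hg k) i).continuous
      (hasCompactSupport_pderivE (hasCompactSupport_component hgc k) i)
  rw [gradNorm, rpow_half_sq (integral_nonneg fun x => Finset.sum_nonneg fun i _ =>
    Finset.sum_nonneg fun k _ => sq_nonneg _),
    integral_finsetSum _ fun i _ => integrable_finsetSum _ fun k _ => h i k]
  exact Finset.sum_congr rfl fun i _ => integral_finsetSum _ fun k _ => h i k

theorem lapNorm_sq (hg : ContDiff ℝ (⊤ : ℕ∞) g) (hgc : HasCompactSupport g) :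
    lapNorm g ^ 2 = ∑ k : Fin 2, ∫ x, lapComp g k x ^ 2 := by
  rw [lapNorm, rpow_half_sq (integral_nonneg fun x => Finset.sum_nonneg fun k _ => sq_nonneg _)]
  exact integral_finsetSum _ fun k _ =>
    integrable_sq (continuous_lapComp hg k) (hasCompactSupport_lapComp hgc k)

theorem integral_sq_le_l2norm_sq (hg : ContDiff ℝ (⊤ : ℕ∞) g) (hgc : HasCompactSupport g)
    (k : Fin 2) : ∫ x, g x k ^ 2 ≤ l2norm g ^ 2 := by
  rw [l2norm_sq hg hgc]
  exact Finset.single_le_sum (f := fun k => ∫ x, g x k ^ 2)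
    (fun k _ => integral_nonneg fun x => sq_nonneg _) (Finset.mem_univ k)

theorem sum_integral_sq_pderivE_le_gradNorm_sq (hg : ContDiff ℝ (⊤ : ℕ∞) g)
    (hgc : HasCompactSupport g) (k : Fin 2) :
    ∑ i : Fin 2, ∫ x, pderivE (fun y => g y k) i x ^ 2 ≤ gradNorm g ^ 2 := by
  rw [gradNorm_sq hg hgc]
  exact Finset.sum_le_sum fun i _ =>
    Finset.single_le_sum (f := fun k => ∫ x, pderivE (fun y => g y k) i x ^ 2)
      (fun k _ => integral_nonneg fun x => sq_nonneg _) (Finset.mem_univ k)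

theorem integral_sq_lapComp_le_lapNorm_sq (hg : ContDiff ℝ (⊤ : ℕ∞) g)
    (hgc : HasCompactSupport g) (k : Fin 2) :
    ∫ x, lapComp g k x ^ 2 ≤ lapNorm g ^ 2 := by
  rw [lapNorm_sq hg hgc]
  exact Finset.single_le_sum (f := fun k => ∫ x, lapComp g k x ^ 2)
    (fun k _ => integral_nonneg fun x => sq_nonneg _) (Finset.mem_univ k)

theorem integral_sq_pderivE_le_gradNorm_sq (hg : ContDiff ℝ (⊤ : ℕ∞) g)
    (hgc : HasCompactSupport g) (i k : Fin 2) :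
    ∫ x, pderivE (fun y => g y k) i x ^ 2 ≤ gradNorm g ^ 2 :=
  (Finset.single_le_sum (f := fun i => ∫ x, pderivE (fun y => g y k) i x ^ 2)
    (fun _ _ => integral_nonneg fun _ => sq_nonneg _) (Finset.mem_univ i)).trans
    (sum_integral_sq_pderivE_le_gradNorm_sq hg hgc k)

theorem sum_integral_sq_pderivE_pderivE_le_lapNorm_sq (hg : ContDiff ℝ (⊤ : ℕ∞) g)
    (hgc : HasCompactSupport g) (i k : Fin 2) :
    ∑ j : Fin 2, ∫ x, pderivE (pderivE (fun y => g y k) i) j x ^ 2 ≤ lapNorm g ^ 2 := by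
  refine le_trans ?_ (integral_sq_lapComp_le_lapNorm_sq hg hgc k)
  refine le_of_le_of_eq ?_ (sum_integral_sq_pderivE_pderivE (contDiff_component hg k)
    (hasCompactSupport_component hgc k))
  exact Finset.single_le_sum
    (f := fun i => ∑ j : Fin 2, ∫ x, pderivE (pderivE (fun y => g y k) i) j x ^ 2)
    (fun _ _ => Finset.sum_nonneg fun _ _ => integral_nonneg fun _ => sq_nonneg _)
    (Finset.mem_univ i)

end VectorNorms

/-- the uniqueness-proof estimate
`|⟨B̃(u,θ₁), Δθ⟩| ≤ κ‖Δθ‖₂² + κ'‖∇u‖₂² + C(κ,κ')‖u‖₂²‖∇θ₁‖₂²‖Δθ₁‖₂²`. -/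
theorem convection_mixed_laplacian_estimate :
    ∀ κ > (0:ℝ), ∀ κ' > (0:ℝ), ∃ C > (0:ℝ), ∀ u θ θ₁ : (Fin 2 → ℝ) → (Fin 2 → ℝ),
      ContDiff ℝ (⊤ : ℕ∞) u → HasCompactSupport u →
      ContDiff ℝ (⊤ : ℕ∞) θ → HasCompactSupport θ →
      ContDiff ℝ (⊤ : ℕ∞) θ₁ → HasCompactSupport θ₁ →
      |∑ i : Fin 2, ∑ k : Fin 2, ∫ x : Fin 2 → ℝ,
          u x i * pderivE (fun y => θ₁ y k) i x * lapComp θ k x| ≤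
        κ * (lapNorm θ) ^ 2 + κ' * (gradNorm u) ^ 2 +
          C * (l2norm u) ^ 2 * (gradNorm θ₁) ^ 2 * (lapNorm θ₁) ^ 2 := by
  intro κ hκ κ' hκ'
  refine ⟨4 * (1 / ((κ / 4) ^ 2 * (κ' / 4))), by positivity,
    fun u θ θ₁ hu huc hθ hθc hθ₁ hθ₁c => ?_⟩
  have hterm (i k : Fin 2) :
      |∫ x : Fin 2 → ℝ, u x i * pderivE (fun y => θ₁ y k) i x * lapComp θ k x| ≤
        κ / 4 * lapNorm θ ^ 2 + κ' / 4 * gradNorm u ^ 2 +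
          1 / ((κ / 4) ^ 2 * (κ' / 4)) * l2norm u ^ 2 * gradNorm θ₁ ^ 2 * lapNorm θ₁ ^ 2 := by
    refine (abs_integral_mul_mul_le (κ := κ / 4) (κ' := κ' / 4) (by positivity) (by positivity)
      (contDiff_component hu i) (hasCompactSupport_component huc i)
      (contDiff_pderivE (contDiff_component hθ₁ k) i)
      (hasCompactSupport_pderivE (hasCompactSupport_component hθ₁c k) i)
      (continuous_lapComp hθ k) (hasCompactSupport_lapComp hθc k)).trans ?_
    have h0 : 0 ≤ ∑ j : Fin 2, ∫ x, pderivE (pderivE (fun y => θ₁ y k) i) j x ^ 2 :=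
      Finset.sum_nonneg fun j _ => integral_nonneg fun x => sq_nonneg _
    have h1 : 0 ≤ ∫ x, pderivE (fun y => θ₁ y k) i x ^ 2 :=
      integral_nonneg fun x => sq_nonneg _
    gcongr
    · exact integral_sq_lapComp_le_lapNorm_sq hθ hθc k
    · exact sum_integral_sq_pderivE_le_gradNorm_sq hu huc i
    · exact integral_sq_le_l2norm_sq hu huc i
    · exact integral_sq_pderivE_le_gradNorm_sq hθ₁ hθ₁c i k
    · exact sum_integral_sq_pderivE_pderivE_le_lapNorm_sq hθ₁ hθ₁c i k
  refine (Finset.abs_sum_le_sum_abs _ _).trans ((Finset.sum_le_sum fun i _ =>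
    (Finset.abs_sum_le_sum_abs _ _).trans (Finset.sum_le_sum fun k _ => hterm i k)).trans_eq ?_)
  simp only [Fin.sum_univ_two]
  ring

end
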